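/- arXiv:1501.02537 — 3 statements merged into one kernel-verified Lean document; each statement's English description precedes it below -/
import Mathlib

section
/- Let T be a bounded linear operator on a separable complex Hilbert space H, let α be a real number with α > 1, and let c ∈ ℂ be nonzero. Then z ⊕ c is a diskcyclic vector for the operator T ⊕ αI_ℂ on H ⊕ ℂ if and only if z is a hypercyclic vector for (1/α)T. -/
open Filter Topology

/-- `x` is a diskcyclic vector for `T`: the disk orbit
`{α • T^n x : n ≥ 0, α ∈ ℂ, |α| ≤ 1}` is dense. -/
def IsDiskcyclicVector {H : Type*} [NormedAddCommGroup H] [NormedSpace ℂ H]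
    (T : H →L[ℂ] H) (x : H) : Prop :=
  Dense {y : H | ∃ (n : ℕ) (α : ℂ), ‖α‖ ≤ 1 ∧ y = α • (T ^ n) x}

/-- `T` is diskcyclic: it has a diskcyclic vector. -/
def IsDiskcyclic {H : Type*} [NormedAddCommGroup H] [NormedSpace ℂ H]
    (T : H →L[ℂ] H) : Prop :=
  ∃ x, IsDiskcyclicVector T x

/-- `x` is a hypercyclic vector for `T`: the orbit `{T^n x : n ≥ 0}` is dense. -/
def IsHypercyclicVector {H : Type*} [NormedAddCommGroup H] [NormedSpace ℂ H]
    (T : H →L[ℂ] H) (x : H) : Prop :=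
  Dense {y : H | ∃ n : ℕ, y = (T ^ n) x}

/-- `T` is hypercyclic: it has a hypercyclic vector. -/
def IsHypercyclic {H : Type*} [NormedAddCommGroup H] [NormedSpace ℂ H]
    (T : H →L[ℂ] H) : Prop :=
  ∃ x, IsHypercyclicVector T x

lemma prodMap_smul_one_pow_apply {H : Type*} [NormedAddCommGroup H] [NormedSpace ℂ H]
    (T : H →L[ℂ] H) (a : ℂ) (n : ℕ) (z : H) (c : ℂ) :
    ((T.prodMap (a • (1 : ℂ →L[ℂ] ℂ))) ^ n) (z, c) = ((T ^ n) z, a ^ n * c) := by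
  induction n with
  | zero => simp
  | succ n ih => simp [pow_succ', ih, mul_assoc]

/-- Removing finitely many initial terms from a dense orbit leaves a dense set. -/
lemma IsHypercyclicVector.dense_tail {H : Type*} [NormedAddCommGroup H] [NormedSpace ℂ H]
    {T : H →L[ℂ] H} {z : H} (h : IsHypercyclicVector T z) (N : ℕ) :
    Dense {y : H | ∃ n ≥ N, y = (T ^ n) z} := by
  rcases subsingleton_or_nontrivial H with hH | hH
  · exact fun y ↦ subset_closure ⟨N, le_rfl, Subsingleton.elim _ _⟩
  · have (x : H) : (𝓝[≠] x).NeBot := Module.punctured_nhds_neBot ℂ H x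
    refine (h.sdiff_finite ((Set.finite_lt_nat N).image fun n ↦ (T ^ n) z)).mono ?_
    rintro y ⟨⟨n, rfl⟩, hn⟩
    exact ⟨n, not_lt.1 fun hlt ↦ hn ⟨n, hlt, rfl⟩, rfl⟩

/-- If `(z, c)` is a diskcyclic vector for `T ⊕ aI_ℂ`, then `z` is a hypercyclic vector for
`a⁻¹T`. -/
lemma IsDiskcyclicVector.isHypercyclicVector_inv_smul {H : Type*} [NormedAddCommGroup H]
    [NormedSpace ℂ H] {T : H →L[ℂ] H} {a : ℂ} {z : H} {c : ℂ} (hc : c ≠ 0)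
    (h : IsDiskcyclicVector (T.prodMap (a • (1 : ℂ →L[ℂ] ℂ))) (z, c)) :
    IsHypercyclicVector (a⁻¹ • T) z := by
  refine dense_iff_inter_open.2 fun V hV ⟨y, hy⟩ ↦ ?_
  have hcont : ContinuousOn (fun p : H × ℂ ↦ (c / p.2) • p.1) {p | p.2 ≠ 0} :=
    (continuousOn_const.div continuousOn_snd fun _ hp ↦ hp).smul continuousOn_fst
  have hopen : IsOpen {p : H × ℂ | p.2 ≠ 0} := isOpen_ne_fun continuous_snd continuous_const
  obtain ⟨p, ⟨hp, hpV⟩, n, b, -, rfl⟩ := dense_iff_inter_open.1 h _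
    (hcont.isOpen_inter_preimage hopen hV) ⟨(y, c), hc, by simpa [hc] using hy⟩
  rw [prodMap_smul_one_pow_apply] at hp hpV
  have hba : b ≠ 0 ∧ a ^ n ≠ 0 := by
    simp only [Prod.smul_mk, smul_eq_mul, Set.mem_ofPred_eq, mul_ne_zero_iff] at hp
    exact ⟨hp.1, hp.2.1⟩
  refine ⟨_, hpV, n, ?_⟩
  simp only [Prod.smul_mk, smul_eq_mul, smul_pow, smul_apply, smul_smul]
  congr 1
  obtain ⟨hb, ha⟩ := hba
  rw [inv_pow]
  field_simp

/-- If `|a| > 1`, `c ≠ 0` and `z` is a hypercyclic vector for `a⁻¹T`, then `(z, c)` is a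
diskcyclic vector for `T ⊕ aI_ℂ`. -/
lemma IsHypercyclicVector.isDiskcyclicVector_prodMap {H : Type*} [NormedAddCommGroup H]
    [NormedSpace ℂ H] {T : H →L[ℂ] H} {a : ℂ} (ha : 1 < ‖a‖) {z : H} {c : ℂ} (hc : c ≠ 0)
    (h : IsHypercyclicVector (a⁻¹ • T) z) :
    IsDiskcyclicVector (T.prodMap (a • (1 : ℂ →L[ℂ] ℂ))) (z, c) := by
  have ha0 : a ≠ 0 := norm_pos_iff.1 (zero_lt_one.trans ha)
  refine dense_closure.1 ((dense_univ.prod (dense_compl_singleton (0 : ℂ))).mono ?_)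
  rintro ⟨y, d⟩ ⟨-, hd : d ≠ 0⟩
  obtain ⟨N, hN⟩ := pow_unbounded_of_one_lt ‖d / c‖ ha
  have hcont : Continuous fun x : H ↦ ((d / c) • x, d) := by fun_prop
  have hmem := map_mem_closure hcont (h.dense_tail N ((c / d) • y))
    (t := {p : H × ℂ | ∃ (n : ℕ) (b : ℂ), ‖b‖ ≤ 1 ∧
      p = b • ((T.prodMap (a • (1 : ℂ →L[ℂ] ℂ))) ^ n) (z, c)}) ?_
  · have hdc : d / c * (c / d) = 1 := by field_simp
    simpa only [smul_smul, hdc, one_smul] using hmem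
  · rintro _ ⟨n, hn, rfl⟩
    refine ⟨n, d / c / a ^ n, ?_, ?_⟩
    · rw [norm_div, norm_pow]
      exact div_le_one_of_le₀ (hN.le.trans (pow_le_pow_right₀ ha.le hn)) (by positivity)
    · beta_reduce
      rw [prodMap_smul_one_pow_apply, Prod.smul_mk, smul_pow, smul_apply,
        smul_smul, inv_pow, div_eq_mul_inv (d / c), smul_eq_mul]
      congr 1
      field_simp

/-- For `α > 1` and `c ≠ 0`, `z ⊕ c` is a diskcyclic vector for `T ⊕ αI_ℂ` iff `z` is a
hypercyclic vector for `(1/α)T`. -/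
theorem diskcyclicVector_prodMap_iff_hypercyclicVector {H : Type*} [NormedAddCommGroup H]
    [InnerProductSpace ℂ H] [CompleteSpace H] [TopologicalSpace.SeparableSpace H]
    (T : H →L[ℂ] H) (α : ℝ) (hα : 1 < α) (z : H) (c : ℂ) (hc : c ≠ 0) :
    IsDiskcyclicVector (T.prodMap ((α : ℂ) • (1 : ℂ →L[ℂ] ℂ))) (z, c) ↔
      IsHypercyclicVector (((α : ℂ))⁻¹ • T) z := by
  refine ⟨fun h ↦ h.isHypercyclicVector_inv_smul hc, fun h ↦ h.isDiskcyclicVector_prodMap ?_ hc⟩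
  rwa [Complex.norm_real, Real.norm_of_nonneg (zero_le_one.trans hα.le)]
end

section
/- Let T be a bounded linear operator on an infinite-dimensional separable complex Hilbert space H that satisfies the Diskcyclic Criterion. Then there exists a dense linear subspace A of H that is invariant under T (T(A) ⊆ A) and such that every nonzero element of A is a diskcyclic vector for T. -/
open Filter Topology

/-- `T` satisfies the Diskcyclic Criterion. -/
def SatisfiesDiskcyclicCriterion {H : Type*} [NormedAddCommGroup H] [NormedSpace ℂ H]
    (T : H →L[ℂ] H) : Prop :=
  ∃ (n : ℕ → ℕ), StrictMono n ∧ (∀ k, 0 < n k) ∧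
    ∃ (X Y : Set H), Dense X ∧ Dense Y ∧
      ∃ S : ℕ → H → H,
        (∀ x ∈ X, ∀ y ∈ Y, Tendsto (fun k => ‖(T ^ (n k)) x‖ * ‖S k y‖) atTop (𝓝 0)) ∧
        (∀ y ∈ Y, Tendsto (fun k => ‖S k y‖) atTop (𝓝 0)) ∧
        (∀ y ∈ Y, Tendsto (fun k => (T ^ (n k)) (S k y)) atTop (𝓝 y))

open Polynomial

section Auxiliary

variable {H : Type*} [NormedAddCommGroup H]

/-- The disk orbits of an operator satisfying the Diskcyclic Criterion join any two nonempty
open sets. -/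
theorem SatisfiesDiskcyclicCriterion.exists_smul_pow_mem [NormedSpace ℂ H] {T : H →L[ℂ] H}
    (hT : SatisfiesDiskcyclicCriterion T) {U V : Set H} (hU : IsOpen U) (hU' : U.Nonempty)
    (hV : IsOpen V) (hV' : V.Nonempty) :
    ∃ v ∈ V, ∃ (n : ℕ) (α : ℂ), ‖α‖ ≤ 1 ∧ α • (T ^ n) v ∈ U := by
  obtain ⟨n, -, -, X, Y, hX, hY, S, h1, h2, h3⟩ := hT
  obtain ⟨x, hxV, hxX⟩ := hX.inter_open_nonempty V hV hV'
  obtain ⟨y, hyU, hyY⟩ := hY.inter_open_nonempty U hU hU'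
  obtain ⟨δ, hδ, hδV⟩ := Metric.isOpen_iff.1 hV x hxV
  obtain ⟨η, hη, hηU⟩ := Metric.isOpen_iff.1 hU y hyU
  obtain ⟨ε, hε, hεδ, hεη⟩ : ∃ ε > 0, ε ≤ δ ∧ ε ≤ η / 2 :=
    ⟨min δ (η / 2), by positivity, min_le_left _ _, min_le_right _ _⟩
  obtain ⟨k, hk1, hk2, hk3⟩ := (((h1 x hxX y hyY).eventually_lt_const
    (show 0 < ε ^ 2 / 2 by positivity)).and (((h2 y hyY).eventually_lt_const hε).and
      (Metric.tendsto_nhds.1 (h3 y hyY) ε hε))).exists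
  obtain ⟨c, hc0, hc1, hca, hcb⟩ : ∃ c : ℝ, 0 < c ∧ c ≤ 1 ∧ c * ‖(T ^ n k) x‖ < ε ∧
      c⁻¹ * ‖S k y‖ < ε := by
    rcases lt_or_ge ‖(T ^ n k) x‖ ε with ha | ha
    · exact ⟨1, one_pos, le_rfl, by simpa using ha, by simpa using hk2⟩
    · have ha0 : 0 < ‖(T ^ n k) x‖ := hε.trans_le ha
      refine ⟨ε / (2 * ‖(T ^ n k) x‖), by positivity, ?_, ?_, ?_⟩
      · rw [div_le_one (by positivity)]
        linarith
      · have : ε / (2 * ‖(T ^ n k) x‖) * ‖(T ^ n k) x‖ = ε / 2 := by field_simp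
        linarith
      · have : (ε / (2 * ‖(T ^ n k) x‖))⁻¹ * ‖S k y‖ =
            2 * (‖(T ^ n k) x‖ * ‖S k y‖) / ε := by field_simp
        rw [this, div_lt_iff₀ hε]
        linarith
  have hc : (c : ℂ) ≠ 0 := by exact_mod_cast hc0.ne'
  have hcn : ‖(c : ℂ)‖ = c := by rw [Complex.norm_real, Real.norm_of_nonneg hc0.le]
  refine ⟨x + (c : ℂ)⁻¹ • S k y, hδV ?_, n k, c, hcn.trans_le hc1, hηU ?_⟩
  · rw [mem_ball_iff_norm, add_sub_cancel_left, norm_smul, norm_inv, hcn]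
    exact hcb.trans_le hεδ
  · rw [mem_ball_iff_norm, map_add, map_smul, smul_add, smul_inv_smul₀ hc, add_sub_assoc]
    rw [dist_eq_norm] at hk3
    calc _ ≤ ‖(c : ℂ) • (T ^ n k) x‖ + ‖(T ^ n k) (S k y) - y‖ := norm_add_le _ _
      _ < η := by
        rw [norm_smul, hcn]
        linarith

/-- An operator on a separable Banach space satisfying the Diskcyclic Criterion is diskcyclic. -/
theorem SatisfiesDiskcyclicCriterion.isDiskcyclic [NormedSpace ℂ H] [CompleteSpace H]
    [TopologicalSpace.SeparableSpace H] {T : H →L[ℂ] H} (hT : SatisfiesDiskcyclicCriterion T) :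
    IsDiskcyclic T := by
  have : SecondCountableTopology H := UniformSpace.secondCountable_of_separable H
  let W : Set H → Set H := fun U => ⋃ (n : ℕ) (α : ℂ) (_ : ‖α‖ ≤ 1), {v | α • (T ^ n) v ∈ U}
  have hd : Dense (⋂ U ∈ TopologicalSpace.countableBasis H, W U) := by
    refine dense_biInter_of_isOpen (fun U hU => ?_)
      (TopologicalSpace.countable_countableBasis H) (fun U hU => ?_)
    · refine isOpen_iUnion fun n => isOpen_iUnion fun α => isOpen_iUnion fun _ => ?_
      exact (TopologicalSpace.isOpen_of_mem_countableBasis hU).preimage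
        ((T ^ n).continuous.const_smul α)
    · refine dense_iff_inter_open.2 fun V hV hV' => ?_
      obtain ⟨v, hv, n, α, hα, h⟩ := hT.exists_smul_pow_mem
        (TopologicalSpace.isOpen_of_mem_countableBasis hU)
        (TopologicalSpace.nonempty_of_mem_countableBasis hU) hV hV'
      exact ⟨v, hv, Set.mem_iUnion.2 ⟨n, Set.mem_iUnion₂.2 ⟨α, hα, h⟩⟩⟩
  obtain ⟨x, hx⟩ := hd.nonempty
  refine ⟨x, (TopologicalSpace.isBasis_countableBasis H).dense_iff.2 fun U hU hU' => ?_⟩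
  have hxU := Set.mem_iInter₂.1 hx U hU
  simp only [W, Set.mem_iUnion, Set.mem_ofPred_eq] at hxU
  obtain ⟨n, α, hα, h⟩ := hxU
  exact ⟨_, h, n, α, hα, rfl⟩

/-- The adjoint of an operator satisfying the Diskcyclic Criterion has no eigenvectors. -/
theorem SatisfiesDiskcyclicCriterion.dual_eq_zero [NormedSpace ℂ H] {T : H →L[ℂ] H}
    (hT : SatisfiesDiskcyclicCriterion T) {φ : H →L[ℂ] ℂ} {c : ℂ}
    (hφ : ∀ x, φ (T x) = c * φ x) : φ = 0 := by
  by_contra hne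
  obtain ⟨n, -, -, X, Y, hX, hY, S, h1, -, h3⟩ := hT
  have hpow : ∀ (m : ℕ) (x : H), φ ((T ^ m) x) = c ^ m * φ x := by
    intro m
    induction m with
    | zero => simp
    | succ m ih =>
      intro x
      rw [pow_succ, mul_apply_eq_comp, ih, hφ, pow_succ, mul_assoc]
  have hopen : IsOpen {x | φ x ≠ 0} := isOpen_ne.preimage φ.continuous
  have hnonempty : {x | φ x ≠ 0}.Nonempty := by
    by_contra h
    exact hne (ContinuousLinearMap.ext fun x => by_contra fun hx => h ⟨x, hx⟩)
  obtain ⟨x, hx, hxX⟩ := hX.inter_open_nonempty _ hopen hnonempty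
  obtain ⟨y, hy, hyY⟩ := hY.inter_open_nonempty _ hopen hnonempty
  have hlim : Tendsto (fun k => ‖φ x‖ * ‖φ ((T ^ n k) (S k y))‖) atTop (𝓝 (‖φ x‖ * ‖φ y‖)) :=
    (((φ.continuous.tendsto y).comp (h3 y hyY)).norm).const_mul _
  have hbound : ∀ k, ‖φ x‖ * ‖φ ((T ^ n k) (S k y))‖ ≤
      ‖φ‖ * ‖φ‖ * (‖(T ^ n k) x‖ * ‖S k y‖) := fun k =>
    calc _ = ‖φ ((T ^ n k) x)‖ * ‖φ (S k y)‖ := by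
          simp only [hpow, norm_mul]
          ring
      _ ≤ (‖φ‖ * ‖(T ^ n k) x‖) * (‖φ‖ * ‖S k y‖) := by
          gcongr <;> exact φ.le_opNorm _
      _ = _ := by ring
  have hle := le_of_tendsto_of_tendsto' hlim ((h1 x hxX y hyY).const_mul (‖φ‖ * ‖φ‖)) hbound
  rw [mul_zero] at hle
  exact absurd hle (not_le.2 (mul_pos (norm_pos_iff.2 hx) (norm_pos_iff.2 hy)))

theorem SatisfiesDiskcyclicCriterion.denseRange_sub_algebraMap [InnerProductSpace ℂ H]
    [CompleteSpace H] {T : H →L[ℂ] H} (hT : SatisfiesDiskcyclicCriterion T) (c : ℂ) :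
    DenseRange (T - algebraMap ℂ (H →L[ℂ] H) c) := by
  have hdense : (T - algebraMap ℂ (H →L[ℂ] H) c).range.topologicalClosure = ⊤ := by
    rw [Submodule.topologicalClosure_eq_top_iff, Submodule.eq_bot_iff]
    intro w hw
    have hφ : innerSL ℂ w = 0 := hT.dual_eq_zero (c := c) fun x => by
      have h := (Submodule.mem_orthogonal' _ w).1 hw _
        (LinearMap.mem_range_self (T - algebraMap ℂ (H →L[ℂ] H) c).toLinearMap x)
      simpa [Algebra.algebraMap_eq_smul_one, inner_sub_right, inner_smul_right, sub_eq_zero]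
        using h
    simpa using DFunLike.congr_fun hφ w
  exact Submodule.dense_iff_topologicalClosure_eq_top.2 hdense

theorem SatisfiesDiskcyclicCriterion.denseRange_aeval [InnerProductSpace ℂ H]
    [CompleteSpace H] {T : H →L[ℂ] H} (hT : SatisfiesDiskcyclicCriterion T) {p : ℂ[X]}
    (hp : p ≠ 0) : DenseRange (aeval T p) := by
  have hroots : ∀ s : Multiset ℂ, DenseRange (aeval T (s.map fun a => X - C a).prod) := by
    intro s
    induction s using Multiset.induction with
    | empty => simpa using Function.surjective_id.denseRange
    | cons a s ih =>
      rw [Multiset.map_cons, Multiset.prod_cons, map_mul, map_sub, aeval_X, aeval_C,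
        ContinuousLinearMap.mul_def, ContinuousLinearMap.coe_comp]
      exact (hT.denseRange_sub_algebraMap a).comp ih (ContinuousLinearMap.continuous _)
  rw [(IsAlgClosed.splits p).eq_prod_roots, map_mul, aeval_C, ContinuousLinearMap.mul_def,
    ContinuousLinearMap.coe_comp]
  refine DenseRange.comp (Function.Surjective.denseRange fun y => ?_) (hroots _)
    (ContinuousLinearMap.continuous _)
  exact ⟨p.leadingCoeff⁻¹ • y, by
    simp [Algebra.algebraMap_eq_smul_one, smul_smul, hp]⟩

/-- Diskcyclic vectors are preserved by operators of dense range commuting with `T`. -/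
theorem IsDiskcyclicVector.map [NormedSpace ℂ H] {T R : H →L[ℂ] H} {x : H}
    (hx : IsDiskcyclicVector T x) (hR : DenseRange R) (hc : Commute R T) :
    IsDiskcyclicVector T (R x) := by
  refine (hR.dense_image R.continuous hx).mono ?_
  rintro _ ⟨_, ⟨n, α, hα, rfl⟩, rfl⟩
  refine ⟨n, α, hα, ?_⟩
  rw [map_smul, ← mul_apply_eq_comp, (hc.pow_right n).eq,
    mul_apply_eq_comp]

end Auxiliary

/-- If `T` satisfies the Diskcyclic Criterion, then `T` has an invariant, dense linear
subspace all of whose nonzero elements are diskcyclic vectors for `T`. -/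
theorem exists_dense_invariant_diskcyclic_subspace_of_criterion {H : Type*}
    [NormedAddCommGroup H] [InnerProductSpace ℂ H] [CompleteSpace H]
    [TopologicalSpace.SeparableSpace H] (h_inf : ¬ FiniteDimensional ℂ H)
    (T : H →L[ℂ] H) (hT : SatisfiesDiskcyclicCriterion T) :
    ∃ A : Submodule ℂ H, Dense (A : Set H) ∧ (∀ a ∈ A, T a ∈ A) ∧
      ∀ a ∈ A, a ≠ 0 → IsDiskcyclicVector T a := by
  obtain ⟨x, hx⟩ := hT.isDiskcyclic
  let ev : ℂ[X] →ₗ[ℂ] H :=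
    { toFun := fun p => aeval T p x
      map_add' := fun p q => by simp
      map_smul' := fun c p => by simp }
  have hT_aeval : ∀ p : ℂ[X], aeval T (X * p) x = T (aeval T p x) := fun p => by simp
  refine ⟨ev.range, hx.mono ?_, ?_, ?_⟩
  · rintro _ ⟨n, α, -, rfl⟩
    exact ⟨C α * X ^ n, by simp [ev, Algebra.algebraMap_eq_smul_one]⟩
  · rintro _ ⟨p, rfl⟩
    exact ⟨X * p, hT_aeval p⟩
  · rintro _ ⟨p, rfl⟩ hne
    have hp : p ≠ 0 := by
      rintro rfl
      exact hne (map_zero ev)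
    refine hx.map (hT.denseRange_aeval hp) ?_
    simpa using (Commute.all p X).map (aeval T)
end

section
/- Let B be the unilateral backward shift on the complex Hilbert space ℓ²(ℕ), i.e., (Bx)(n) = x(n+1) for all n ∈ ℕ, and let λ ∈ ℂ with |λ| > 1. Then (1) there exists a dense linear subspace of ℓ²(ℕ), invariant under λB, all of whose nonzero elements are diskcyclic vectors for λB, and (2) every closed linear subspace of ℓ²(ℕ) all of whose nonzero elements are diskcyclic vectors for λB is finite-dimensional. -/
open Filter Topology

section Abstract

variable {H : Type*} [NormedAddCommGroup H] [NormedSpace ℂ H]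

theorem smul_clm_pow_apply (l : ℂ) (B : H →L[ℂ] H) (n : ℕ) (x : H) :
    ((l • B) ^ n) x = l ^ n • (B ^ n) x := by
  rw [smul_pow]; rfl

theorem exists_pow_preimage_norm_eq {B : H →L[ℂ] H} (hr : ∀ u, ∃ w, B w = u ∧ ‖w‖ = ‖u‖)
    (n : ℕ) (u : H) : ∃ w, (B ^ n) w = u ∧ ‖w‖ = ‖u‖ := by
  induction n with
  | zero => exact ⟨u, by simp, rfl⟩
  | succ n ih =>
    obtain ⟨w, hw, hwn⟩ := ih
    obtain ⟨w', hw', hwn'⟩ := hr w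
    exact ⟨w', by rw [pow_succ, mul_apply_eq_comp, hw', hw], hwn'.trans hwn⟩

/-- A scalar multiple `l • B`, `|l| > 1`, of an operator `B` with isometric preimages and whose
powers tend strongly to zero is hypercyclic. -/
theorem isHypercyclic_smul [CompleteSpace H] [SecondCountableTopology H] {B : H →L[ℂ] H}
    (h0 : ∀ x, Tendsto (fun n => ‖(B ^ n) x‖) atTop (𝓝 0))
    (hr : ∀ u, ∃ w, B w = u ∧ ‖w‖ = ‖u‖) {l : ℂ} (hl : 1 < ‖l‖) :
    IsHypercyclic (l • B) := by
  obtain ⟨S, hSc, hSe, hS⟩ := TopologicalSpace.exists_countable_basis H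
  have : Countable S := hSc
  have hl0 : l ≠ 0 := norm_pos_iff.1 (zero_lt_one.trans hl)
  have hdense : Dense (⋂ U : S, ⋃ n : ℕ, ((l • B) ^ n) ⁻¹' (U : Set H)) := by
    refine dense_iInter_of_isOpen
      (fun U => isOpen_iUnion fun n => (hS.isOpen U.2).preimage ((l • B) ^ n).continuous) ?_
    rintro ⟨U, hU⟩
    obtain ⟨u, hu⟩ : U.Nonempty := Set.nonempty_iff_ne_empty.2 fun h => hSe (h ▸ hU)
    refine Metric.dense_iff.2 fun v r hrpos => ?_
    have hpow : Tendsto (fun n : ℕ => ‖((l ^ n)⁻¹) • u‖) atTop (𝓝 0) := by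
      have := (tendsto_pow_atTop_nhds_zero_of_lt_one (norm_nonneg l⁻¹)
        (by rw [norm_inv]; exact inv_lt_one_of_one_lt₀ hl)).mul_const ‖u‖
      simpa [norm_smul] using this
    obtain ⟨n, hn₁, hn₂⟩ := (((h0 v).eventually_lt_const (half_pos hrpos)).and
      (hpow.eventually_lt_const (half_pos hrpos))).exists
    obtain ⟨w, hw, hwn⟩ := exists_pow_preimage_norm_eq hr n ((B ^ n) v)
    obtain ⟨w', hw', hwn'⟩ := exists_pow_preimage_norm_eq hr n ((l ^ n)⁻¹ • u)
    refine ⟨v - w + w', ?_, Set.mem_iUnion.2 ⟨n, ?_⟩⟩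
    · rw [mem_ball_iff_norm, show v - w + w' - v = w' - w by abel]
      exact (norm_sub_le _ _).trans_lt (by rw [hwn, hwn']; linarith)
    · rw [Set.mem_preimage, smul_clm_pow_apply, map_add, map_sub, hw, hw', sub_self, zero_add,
        smul_smul, mul_inv_cancel₀ (pow_ne_zero _ hl0), one_smul]
      exact hu
  obtain ⟨x, hx⟩ := hdense.nonempty
  refine ⟨x, hS.dense_iff.2 fun U hU _ => ?_⟩
  obtain ⟨n, hn⟩ := Set.mem_iUnion.1 (Set.mem_iInter.1 hx ⟨U, hU⟩)
  exact ⟨((l • B) ^ n) x, hn, n, rfl⟩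

theorem IsHypercyclicVector.isDiskcyclicVector {T : H →L[ℂ] H} {x : H}
    (hx : IsHypercyclicVector T x) : IsDiskcyclicVector T x := by
  refine hx.mono ?_
  rintro _ ⟨n, rfl⟩
  exact ⟨n, 1, by simp, by simp⟩

/-- `l • B - μ` has dense range when `B` has isometric preimages and its powers tend strongly
to zero. -/
theorem denseRange_smul_sub_algebraMap {B : H →L[ℂ] H}
    (h0 : ∀ x, Tendsto (fun n => ‖(B ^ n) x‖) atTop (𝓝 0))
    (hr : ∀ u, ∃ w, B w = u ∧ ‖w‖ = ‖u‖) {l : ℂ} (hl : l ≠ 0) (μ : ℂ) :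
    DenseRange (l • B - algebraMap ℂ (H →L[ℂ] H) μ) := by
  set S := l • B - algebraMap ℂ (H →L[ℂ] H) μ with hS
  have hSapp (y : H) : S y = l • B y - μ • y := by simp [hS, Algebra.algebraMap_eq_smul_one]
  rcases eq_or_ne μ 0 with rfl | hμ
  · refine Function.Surjective.denseRange fun y => ?_
    obtain ⟨w, hw, -⟩ := hr (l⁻¹ • y)
    exact ⟨w, by rw [hSapp, hw, smul_smul, mul_inv_cancel₀ hl, one_smul, zero_smul, sub_zero]⟩
  · have hker : ∀ (N : ℕ) (y : H), (B ^ N) y = 0 → y ∈ Set.range S := by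
      intro N
      induction N with
      | zero => exact fun y hy => ⟨0, by simpa using hy.symm⟩
      | succ N ih =>
        intro y hy
        obtain ⟨z, hz⟩ := ih (l • B y) (by
          rw [map_smul, ← mul_apply_eq_comp, ← pow_succ, hy, smul_zero])
        refine ⟨μ⁻¹ • (z - y), ?_⟩
        rw [map_smul, map_sub, hz, hSapp, sub_sub_cancel, smul_smul, inv_mul_cancel₀ hμ, one_smul]
    refine Metric.dense_iff.2 fun y r hrpos => ?_
    obtain ⟨n, hn⟩ := ((h0 y).eventually_lt_const hrpos).exists
    obtain ⟨w, hw, hwn⟩ := exists_pow_preimage_norm_eq hr n ((B ^ n) y)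
    refine ⟨y - w, ?_, hker n _ (by rw [map_sub, hw, sub_self])⟩
    rw [mem_ball_iff_norm, sub_sub_cancel_left, norm_neg, hwn]
    exact hn

theorem denseRange_aeval {T : H →L[ℂ] H}
    (hT : ∀ μ : ℂ, DenseRange (T - algebraMap ℂ (H →L[ℂ] H) μ)) {p : Polynomial ℂ}
    (hp : p ≠ 0) : DenseRange (Polynomial.aeval T p) := by
  have hprod (s : Multiset ℂ) : DenseRange (Polynomial.aeval T
      (s.map fun a => Polynomial.X - Polynomial.C a).prod) := by
    induction s using Multiset.induction_on with
    | empty => simpa using Function.surjective_id.denseRange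
    | cons a s ih =>
      rw [Multiset.map_cons, Multiset.prod_cons, map_mul, map_sub, Polynomial.aeval_X,
        Polynomial.aeval_C]
      exact (hT a).comp ih (ContinuousLinearMap.continuous _)
  have hlead : p.leadingCoeff ≠ 0 := Polynomial.leadingCoeff_ne_zero.2 hp
  rw [(IsAlgClosed.splits p).eq_prod_roots, map_mul, Polynomial.aeval_C]
  refine DenseRange.comp (g := algebraMap ℂ (H →L[ℂ] H) p.leadingCoeff)
    (Function.Surjective.denseRange fun y => ⟨p.leadingCoeff⁻¹ • y, ?_⟩) (hprod _)
    (ContinuousLinearMap.continuous _)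
  simp [Algebra.algebraMap_eq_smul_one, smul_smul, hlead]

theorem IsDiskcyclicVector.map_of_commute {T S : H →L[ℂ] H} {x : H}
    (hx : IsDiskcyclicVector T x) (hS : DenseRange S) (hST : Commute S T) :
    IsDiskcyclicVector T (S x) := by
  refine (hS.dense_image S.continuous hx).mono ?_
  rintro _ ⟨_, ⟨n, α, hα, rfl⟩, rfl⟩
  refine ⟨n, α, hα, ?_⟩
  rw [map_smul, ← mul_apply_eq_comp, (hST.pow_right n).eq,
    mul_apply_eq_comp]

/-- If `x` is diskcyclic for `T` and `T - μ` has dense range for every `μ`, then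
`{p(T) x : p ∈ ℂ[X]}` is a dense invariant subspace of diskcyclic vectors. -/
theorem IsDiskcyclicVector.exists_dense_invariant_submodule {T : H →L[ℂ] H} {x : H}
    (hx : IsDiskcyclicVector T x)
    (hT : ∀ μ : ℂ, DenseRange (T - algebraMap ℂ (H →L[ℂ] H) μ)) :
    ∃ A : Submodule ℂ H, Dense (A : Set H) ∧ (∀ a ∈ A, T a ∈ A) ∧
      ∀ a ∈ A, a ≠ 0 → IsDiskcyclicVector T a := by
  let e : Polynomial ℂ →ₗ[ℂ] H :=
    { toFun := fun p => Polynomial.aeval T p x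
      map_add' := fun p q => by simp
      map_smul' := fun c p => by simp }
  have he (p : Polynomial ℂ) : e p = Polynomial.aeval T p x := rfl
  refine ⟨LinearMap.range e, hx.mono ?_, ?_, ?_⟩
  · rintro _ ⟨n, α, -, rfl⟩
    exact ⟨α • Polynomial.X ^ n, by simp [he]⟩
  · rintro _ ⟨p, rfl⟩
    exact ⟨Polynomial.X * p, by simp [he]⟩
  · rintro _ ⟨p, rfl⟩ hne
    have hp : p ≠ 0 := by rintro rfl; exact hne (map_zero e)
    refine hx.map_of_commute (denseRange_aeval hT hp) ?_
    simpa using (Commute.all p Polynomial.X).map (Polynomial.aeval T)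

/-- If every power of a contraction `B` with strongly vanishing powers is isometric on some unit
vector of the closed subspace `M`, then some orbit starting in `M` decays at most
geometrically. -/
theorem exists_norm_pow_le_mul_norm_pow_succ [CompleteSpace H] {B : H →L[ℂ] H}
    (hB : ∀ x, ‖B x‖ ≤ ‖x‖) (h0 : ∀ x, Tendsto (fun n => ‖(B ^ n) x‖) atTop (𝓝 0))
    {M : Submodule ℂ H} (hMc : IsClosed (M : Set H))
    (hM : ∀ N : ℕ, ∃ v ∈ M, ‖v‖ = 1 ∧ ‖(B ^ N) v‖ = 1) :
    ∃ z ∈ M, z ≠ 0 ∧ ∀ n : ℕ, ‖(B ^ n) z‖ ≤ 24 * ‖(B ^ (n + 1)) z‖ := by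
  have hanti (x : H) : Antitone fun n => ‖(B ^ n) x‖ :=
    antitone_nat_of_succ_le fun n => by
      rw [pow_succ', mul_apply_eq_comp]; exact hB _
  have hcontr (n : ℕ) (x : H) : ‖(B ^ n) x‖ ≤ ‖x‖ := by simpa using hanti x (Nat.zero_le n)
  have hstep (s : H) (K : ℕ) : ∃ (N : ℕ) (v : H), K ≤ N ∧ v ∈ M ∧ ‖v‖ = 1 ∧ ‖(B ^ N) v‖ = 1 ∧
      ‖(B ^ N) s‖ < (1 / 4 : ℝ) ^ K / 3 := by
    obtain ⟨N, hN, hKN⟩ := (((h0 s).eventually_lt_const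
      (show (0 : ℝ) < (1 / 4 : ℝ) ^ K / 3 by positivity)).and (eventually_ge_atTop K)).exists
    obtain ⟨v, hv, hv1, hvN⟩ := hM N
    exact ⟨N, v, hKN, hv, hv1, hvN, hN⟩
  choose N v hKN hvM hv1 hvN hNs using hstep
  let s : ℕ → H := fun n => Nat.rec 0 (fun K s => s + (1 / 4 : ℂ) ^ K • v s K) n
  have hs (K : ℕ) : s (K + 1) = s K + (1 / 4 : ℂ) ^ K • v (s K) K := rfl
  have hsM (K : ℕ) : s K ∈ M := by
    induction K with
    | zero => exact M.zero_mem
    | succ K ih => rw [hs]; exact M.add_mem ih (M.smul_mem _ (hvM _ _))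
  have hdist (K : ℕ) : dist (s K) (s (K + 1)) ≤ 1 * (1 / 4 : ℝ) ^ K := by
    rw [hs, dist_self_add_right, norm_smul, hv1]; simp
  obtain ⟨z, hz⟩ := cauchySeq_tendsto_of_complete
    (cauchySeq_of_le_geometric (1 / 4 : ℝ) 1 (by norm_num) hdist)
  have hzs (K : ℕ) : ‖z - s K‖ ≤ 4 / 3 * (1 / 4 : ℝ) ^ K := by
    have := dist_le_of_le_geometric_of_tendsto (1 / 4 : ℝ) 1 (by norm_num) hdist hz K
    rw [dist_eq_norm'] at this
    exact this.trans_eq (by ring)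
  have hdecomp (K : ℕ) : (B ^ N (s K) K) z = (1 / 4 : ℂ) ^ K • (B ^ N (s K) K) (v (s K) K) +
      ((B ^ N (s K) K) (s K) + (B ^ N (s K) K) (z - s (K + 1))) := by
    rw [map_sub, hs, map_add, map_smul]; abel
  have herr (K : ℕ) : ‖(B ^ N (s K) K) (s K) + (B ^ N (s K) K) (z - s (K + 1))‖ ≤
      2 / 3 * (1 / 4 : ℝ) ^ K := by
    have h1 := (hcontr (N (s K) K) _).trans (hzs (K + 1))
    have h2 := hNs (s K) K
    rw [pow_succ] at h1
    exact (norm_add_le _ _).trans (by linarith)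
  have hmain (K : ℕ) : ‖(1 / 4 : ℂ) ^ K • (B ^ N (s K) K) (v (s K) K)‖ = (1 / 4 : ℝ) ^ K := by
    rw [norm_smul, hvN]; simp
  have hupper (K : ℕ) : ‖(B ^ N (s K) K) z‖ ≤ 2 * (1 / 4 : ℝ) ^ K := by
    rw [hdecomp]
    have : (0 : ℝ) < (1 / 4 : ℝ) ^ K := by positivity
    exact (norm_add_le _ _).trans (by linarith [hmain K, herr K])
  have hlower (K : ℕ) : 1 / 3 * (1 / 4 : ℝ) ^ K ≤ ‖(B ^ N (s K) K) z‖ := by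
    rw [hdecomp]
    have := norm_sub_le_norm_add ((1 / 4 : ℂ) ^ K • (B ^ N (s K) K) (v (s K) K))
      ((B ^ N (s K) K) (s K) + (B ^ N (s K) K) (z - s (K + 1)))
    linarith [hmain K, herr K]
  refine ⟨z, hMc.mem_of_tendsto hz (Eventually.of_forall hsM), ?_, fun n => ?_⟩
  · rintro rfl
    have := hlower 0
    norm_num at this
  · have hex : ∃ K, n < N (s K) K := ⟨n + 1, hKN (s (n + 1)) (n + 1)⟩
    classical
    have hlow := (hlower (Nat.find hex)).trans (hanti z (Nat.find_spec hex))
    rcases hK : Nat.find hex with _ | K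
    · rw [hK] at hlow
      have := (hcontr n z).trans (by simpa [show s 0 = 0 from rfl] using hzs 0)
      rw [pow_zero] at hlow
      linarith
    · rw [hK, pow_succ] at hlow
      have hle : N (s K) K ≤ n := not_lt.1 (Nat.find_min hex (by omega))
      have := (hanti z hle).trans (hupper K)
      linarith

theorem not_isDiskcyclicVector_of_norm_pow_le {B : H →L[ℂ] H} {C : ℝ} {z e : H} (he : e ≠ 0)
    (hBe : B e = 0) (hz : ∀ n : ℕ, ‖(B ^ n) z‖ ≤ C * ‖(B ^ (n + 1)) z‖) (l : ℂ) :
    ¬ IsDiskcyclicVector (l • B) z := by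
  intro h
  have hclosed : IsClosed {w : H | ‖w‖ ≤ C * ‖B w‖} :=
    isClosed_le (by fun_prop) (by fun_prop)
  have hsub : {y : H | ∃ (n : ℕ) (α : ℂ), ‖α‖ ≤ 1 ∧ y = α • ((l • B) ^ n) z} ⊆
      {w : H | ‖w‖ ≤ C * ‖B w‖} := by
    rintro _ ⟨n, α, -, rfl⟩
    have := mul_le_mul_of_nonneg_left (hz n) (norm_nonneg (α * l ^ n))
    rw [pow_succ', mul_apply_eq_comp] at this
    rw [Set.mem_ofPred_eq, smul_clm_pow_apply, smul_smul, map_smul, norm_smul, norm_smul]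
    linarith
  have hmem : e ∈ {w : H | ‖w‖ ≤ C * ‖B w‖} := closure_minimal hsub hclosed (h e)
  rw [Set.mem_ofPred_eq, hBe, norm_zero, mul_zero] at hmem
  exact he (norm_le_zero_iff.1 hmem)

end Abstract

section BackwardShift

variable {B : lp (fun _ : ℕ => ℂ) 2 →L[ℂ] lp (fun _ : ℕ => ℂ) 2}

theorem hasSum_sq_norm_lp_two (x : lp (fun _ : ℕ => ℂ) 2) :
    HasSum (fun i => ‖x i‖ ^ 2) (‖x‖ ^ 2) := by
  simpa using lp.hasSum_norm (p := 2) (by norm_num) x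

theorem backwardShift_pow_apply
    (hB : ∀ (x : lp (fun _ : ℕ => ℂ) 2) (n : ℕ), B x n = x (n + 1))
    (n : ℕ) (x : lp (fun _ : ℕ => ℂ) 2) (k : ℕ) : (B ^ n) x k = x (k + n) := by
  induction n generalizing x with
  | zero => simp
  | succ n ih => rw [pow_succ, mul_apply_eq_comp, ih, hB, add_assoc]

theorem norm_backwardShift_pow_sq
    (hB : ∀ (x : lp (fun _ : ℕ => ℂ) 2) (n : ℕ), B x n = x (n + 1))
    (n : ℕ) (x : lp (fun _ : ℕ => ℂ) 2) :
    ‖(B ^ n) x‖ ^ 2 = ‖x‖ ^ 2 - ∑ i ∈ Finset.range n, ‖x i‖ ^ 2 := by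
  have h := hasSum_sq_norm_lp_two ((B ^ n) x)
  simp only [backwardShift_pow_apply hB] at h
  exact h.unique ((hasSum_nat_add_iff' n).2 (hasSum_sq_norm_lp_two x))

theorem tendsto_norm_backwardShift_pow
    (hB : ∀ (x : lp (fun _ : ℕ => ℂ) 2) (n : ℕ), B x n = x (n + 1))
    (x : lp (fun _ : ℕ => ℂ) 2) : Tendsto (fun n => ‖(B ^ n) x‖) atTop (𝓝 0) := by
  have h : Tendsto (fun n => ‖(B ^ n) x‖ ^ 2) atTop (𝓝 0) := by
    simp only [norm_backwardShift_pow_sq hB]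
    rw [← sub_self (‖x‖ ^ 2)]
    exact (hasSum_sq_norm_lp_two x).tendsto_sum_nat.const_sub (‖x‖ ^ 2)
  simpa [Real.sqrt_sq] using h.sqrt

theorem norm_backwardShift_le
    (hB : ∀ (x : lp (fun _ : ℕ => ℂ) 2) (n : ℕ), B x n = x (n + 1))
    (x : lp (fun _ : ℕ => ℂ) 2) : ‖B x‖ ≤ ‖x‖ := by
  have h := norm_backwardShift_pow_sq hB 1 x
  rw [pow_one, Finset.sum_range_one] at h
  exact le_of_sq_le_sq (by nlinarith [sq_nonneg ‖x 0‖]) (norm_nonneg x)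

theorem exists_backwardShift_preimage
    (hB : ∀ (x : lp (fun _ : ℕ => ℂ) 2) (n : ℕ), B x n = x (n + 1))
    (u : lp (fun _ : ℕ => ℂ) 2) : ∃ w, B w = u ∧ ‖w‖ = ‖u‖ := by
  let f : ℕ → ℂ := fun n => Nat.casesOn n 0 u
  have hf : Memℓp f 2 := by
    refine memℓp_gen ((summable_nat_add_iff 1).1 ?_)
    simpa [f] using (hasSum_sq_norm_lp_two u).summable
  have hBf : B ⟨f, hf⟩ = u := by
    ext n
    rw [hB]
  refine ⟨⟨f, hf⟩, hBf, ?_⟩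
  have h := norm_backwardShift_pow_sq hB 1 ⟨f, hf⟩
  rw [pow_one, hBf, Finset.sum_range_one] at h
  refine (sq_eq_sq₀ (norm_nonneg _) (norm_nonneg _)).1 ?_
  simpa [f] using h.symm

theorem separableSpace_lp_two : TopologicalSpace.SeparableSpace (lp (fun _ : ℕ => ℂ) 2) := by
  have hsep : TopologicalSpace.IsSeparable
      (Submodule.span ℂ (Set.range fun n : ℕ => lp.single (E := fun _ : ℕ => ℂ) 2 n (1 : ℂ)) :
        Set (lp (fun _ : ℕ => ℂ) 2)) :=
    (Set.countable_range _).isSeparable.span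
  refine TopologicalSpace.isSeparable_univ_iff.1 (hsep.closure.mono fun x _ => ?_)
  refine mem_closure_of_tendsto (lp.hasSum_single (by norm_num) x)
    (Eventually.of_forall fun s => Submodule.sum_mem _ fun i _ => ?_)
  have : lp.single (E := fun _ : ℕ => ℂ) 2 i (x i) = x i • lp.single 2 i (1 : ℂ) := by
    rw [← lp.single_smul, smul_eq_mul, mul_one]
  rw [this]
  exact Submodule.smul_mem _ _ (Submodule.subset_span ⟨i, rfl⟩)

theorem exists_unit_mem_norm_backwardShift_pow_eq_one
    (hB : ∀ (x : lp (fun _ : ℕ => ℂ) 2) (n : ℕ), B x n = x (n + 1))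
    {M : Submodule ℂ (lp (fun _ : ℕ => ℂ) 2)} (hM : ¬ FiniteDimensional ℂ M) (N : ℕ) :
    ∃ v ∈ M, ‖v‖ = 1 ∧ ‖(B ^ N) v‖ = 1 := by
  let e : M →ₗ[ℂ] (Fin N → ℂ) :=
    { toFun := fun x i => (x : lp (fun _ : ℕ => ℂ) 2) i
      map_add' := fun x y => by ext; simp
      map_smul' := fun c x => by ext; simp }
  obtain ⟨v, hv, hv0⟩ : ∃ v : M, e v = 0 ∧ v ≠ 0 := by
    by_contra! h
    exact hM (Module.Finite.of_injective e ((injective_iff_map_eq_zero e).2 h))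
  have hv0' : (v : lp (fun _ : ℕ => ℂ) 2) ≠ 0 := by simpa using hv0
  have hnorm : ‖(B ^ N) (v : lp (fun _ : ℕ => ℂ) 2)‖ = ‖(v : lp (fun _ : ℕ => ℂ) 2)‖ := by
    refine (sq_eq_sq₀ (norm_nonneg _) (norm_nonneg _)).1 ?_
    rw [norm_backwardShift_pow_sq hB, Finset.sum_eq_zero, sub_zero]
    intro i hi
    have : (v : lp (fun _ : ℕ => ℂ) 2) i = 0 := congrFun hv ⟨i, Finset.mem_range.1 hi⟩
    rw [this, norm_zero, zero_pow two_ne_zero]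
  have hunit := norm_smul_inv_norm (𝕜 := ℂ) hv0'
  refine ⟨_, M.smul_mem _ v.2, hunit, ?_⟩
  rw [map_smul, norm_smul, hnorm, ← norm_smul, hunit]

end BackwardShift

/-- For the unilateral backward shift `B` on `ℓ²(ℕ)` and `|λ| > 1`: `λB` has an invariant,
dense linear subspace of diskcyclic vectors, but every closed linear subspace all of whose
nonzero elements are diskcyclic vectors for `λB` is finite-dimensional. -/
theorem backwardShift_diskcyclic_subspaces
    (B : lp (fun _ : ℕ => ℂ) 2 →L[ℂ] lp (fun _ : ℕ => ℂ) 2)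
    (hB : ∀ (x : lp (fun _ : ℕ => ℂ) 2) (n : ℕ), B x n = x (n + 1))
    (l : ℂ) (hl : 1 < ‖l‖) :
    (∃ A : Submodule ℂ (lp (fun _ : ℕ => ℂ) 2),
      Dense (A : Set (lp (fun _ : ℕ => ℂ) 2)) ∧ (∀ a ∈ A, (l • B) a ∈ A) ∧
      ∀ a ∈ A, a ≠ 0 → IsDiskcyclicVector (l • B) a) ∧
    (∀ M : Submodule ℂ (lp (fun _ : ℕ => ℂ) 2),
      IsClosed (M : Set (lp (fun _ : ℕ => ℂ) 2)) →
      (∀ z ∈ M, z ≠ 0 → IsDiskcyclicVector (l • B) z) →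
      FiniteDimensional ℂ M) := by
  have h0 := tendsto_norm_backwardShift_pow hB
  have hr := exists_backwardShift_preimage hB
  constructor
  · have := separableSpace_lp_two
    have := UniformSpace.secondCountable_of_separable (lp (fun _ : ℕ => ℂ) 2)
    obtain ⟨x, hx⟩ := isHypercyclic_smul h0 hr hl
    exact hx.isDiskcyclicVector.exists_dense_invariant_submodule
      (denseRange_smul_sub_algebraMap h0 hr (norm_pos_iff.1 (zero_lt_one.trans hl)))
  · intro M hMc hMd
    by_contra hM
    obtain ⟨z, hzM, hz0, hz⟩ := exists_norm_pow_le_mul_norm_pow_succ (norm_backwardShift_le hB) h0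
      hMc (exists_unit_mem_norm_backwardShift_pow_eq_one hB hM)
    have he : lp.single (E := fun _ : ℕ => ℂ) 2 0 (1 : ℂ) ≠ 0 := fun h => by
      simpa using congrArg (fun x : lp (fun _ : ℕ => ℂ) 2 => x 0) h
    have hBe : B (lp.single 2 0 (1 : ℂ)) = 0 := by
      ext n
      rw [hB, lp.single_apply_ne _ _ _ n.succ_ne_zero]
      rfl
    exact not_isDiskcyclicVector_of_norm_pow_le he hBe hz l (hMd z hzM hz0)
end
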